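/- Let (X_η, S) be a B-free subshift. If X_η is hereditary, then the automorphism group of (X_η, S) is trivial: every bijective cellular automaton τ on (X_η, S) equals S^n for some n ∈ ℤ. -/

import Mathlib

open Filter Set

noncomputable section

/-- The shift by `t`: `(shiftPow t x) n = x (n + t)`, i.e. `S^t`. -/
def shiftPow (t : ℤ) (x : ℤ → Bool) : ℤ → Bool := fun n => x (n + t)

/-- The left shift `S`, `(S x) n = x (n + 1)`. -/
def shift : (ℤ → Bool) → (ℤ → Bool) := shiftPow 1

/-- The support of a `0-1`-sequence. -/
def supp (x : ℤ → Bool) : Set ℤ := {n | x n = true}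

/-- The all-zero sequence `0^ℤ`. -/
def zeroSeq : ℤ → Bool := fun _ => false

/-- The all-one sequence `1^ℤ`. -/
def oneSeq : ℤ → Bool := fun _ => true

/-- The sequence `u = 0^{-ℕ} 1 0^{ℕ}` with a single `1` at position `0`. -/
def uSeq : ℤ → Bool := fun n => if n = 0 then true else false

/-- The set `F_B ⊆ ℤ` of `B`-free integers. -/
def BFreeSet (B : Set ℕ) : Set ℤ := {n | ∀ b ∈ B, ¬ ((b : ℤ) ∣ n)}

open Classical in
/-- `η`, the indicator function of the `B`-free integers. -/
noncomputable def eta (B : Set ℕ) : ℤ → Bool := fun n => if n ∈ BFreeSet B then true else false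

/-- The `B`-free subshift `X_η`: the orbit closure of `η` under the shift. -/
def Xeta (B : Set ℕ) : Set (ℤ → Bool) := closure {x | ∃ t : ℤ, x = shiftPow t (eta B)}

/-- A set `A ⊆ ℤ` is `B`-admissible if for every `b ∈ B` some residue class
mod `b` is disjoint from `A`. -/
def IsBAdmissible (B : Set ℕ) (A : Set ℤ) : Prop :=
  ∀ b ∈ B, ∃ r : ℤ, ∀ a ∈ A, ¬ ((b : ℤ) ∣ (a - r))

/-- The `B`-admissible subshift `X_B`. -/
def XB (B : Set ℕ) : Set (ℤ → Bool) := {x | IsBAdmissible B (supp x)}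

/-- `B` is primitive: no element divides a different element. -/
def Primitive (B : Set ℕ) : Prop := ∀ a ∈ B, ∀ b ∈ B, a ∣ b → a = b

/-- `B` is an Erdős set: infinite, `1 ∉ B` (elements positive), primitive, pairwise
coprime and thin. -/
def IsErdos (B : Set ℕ) : Prop :=
  B.Infinite ∧ (∀ b ∈ B, 2 ≤ b) ∧ Primitive B ∧
    (∀ a ∈ B, ∀ b ∈ B, a ≠ b → Nat.Coprime a b) ∧
    Summable (fun b : B => (1 : ℝ) / (b : ℝ))

/-- A cellular automaton on `X`: a continuous self-map of `X` commuting with the shift. -/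
def IsCA (X : Set (ℤ → Bool)) (τ : (ℤ → Bool) → (ℤ → Bool)) : Prop :=
  Set.MapsTo τ X X ∧ ContinuousOn τ X ∧ ∀ x ∈ X, τ (shift x) = shift (τ x)

/-- Pre-injectivity of a CA on `X`. -/
def PreInjective (X : Set (ℤ → Bool)) (τ : (ℤ → Bool) → (ℤ → Bool)) : Prop :=
  ∀ x ∈ X, ∀ y ∈ X, τ x = τ y → {n : ℤ | x n ≠ y n}.Finite → x = y

/-- `X` is hereditary. -/
def Hereditary (X : Set (ℤ → Bool)) : Prop :=
  ∀ x ∈ X, ∀ y : ℤ → Bool, (∀ n, y n ≤ x n) → y ∈ X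

/-- The hereditary closure `X̃` of a set `X`. -/
def heredClosure (X : Set (ℤ → Bool)) : Set (ℤ → Bool) :=
  {y | ∃ x ∈ X, ∀ n, y n ≤ x n}

/-- `X` is a subshift: nonempty, closed and shift-invariant. -/
def IsSubshift (X : Set (ℤ → Bool)) : Prop :=
  X.Nonempty ∧ IsClosed X ∧ shift '' X = X

/-- `τ` is given by a (sliding block) code of radius `ℓ` on `X`. -/
def HasRadius (X : Set (ℤ → Bool)) (τ : (ℤ → Bool) → (ℤ → Bool)) (ℓ : ℕ) : Prop :=
  ∀ x ∈ X, ∀ y ∈ X, ∀ n : ℤ,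
    (∀ i : ℤ, n - ℓ ≤ i → i ≤ n + ℓ → x i = y i) → τ x n = τ y n

open Classical in
/-- `A ⊆ ℤ` has logarithmic density `d`. -/
noncomputable def HasLogDensity (A : Set ℤ) (d : ℝ) : Prop :=
  Tendsto (fun N : ℕ =>
      (Real.log N)⁻¹ * ∑ n ∈ Finset.Icc 1 N, (if (n : ℤ) ∈ A then (1 : ℝ) / (n : ℝ) else 0))
    atTop (nhds d)

/-- `B` is taut: removing any `b ∈ B` strictly increases the logarithmic density of the
`B`-free integers. -/
def IsTaut (B : Set ℕ) : Prop :=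
  ∀ b ∈ B, ∀ d d' : ℝ,
    HasLogDensity (BFreeSet B) d → HasLogDensity (BFreeSet (B \ {b})) d' → d < d'

/-- `x` and `y` are proximal: along some sequence `r k → ∞`, the shifted sequences
`S^{r k} x` and `S^{r k} y` agree on arbitrarily large central windows, i.e.
`d(S^{r k} x, S^{r k} y) → 0` in the product topology. -/
def ProximalPair (x y : ℤ → Bool) : Prop :=
  ∃ r : ℕ → ℤ, Tendsto r atTop atTop ∧
    ∀ m : ℕ, ∀ᶠ k in atTop, ∀ n : ℤ, |n| ≤ (m : ℤ) →
      shiftPow (r k) x n = shiftPow (r k) y n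

/-- A subshift is proximal if every pair of its points is proximal. -/
def IsProximalSubshift (X : Set (ℤ → Bool)) : Prop :=
  ∀ x ∈ X, ∀ y ∈ X, ProximalPair x y

end

/-- The indicator sequence of a finite set of integers. -/
def indicatorSeq (A : Finset ℤ) : ℤ → Bool := fun n => decide (n ∈ A)

theorem eta_eq_true_iff {B : Set ℕ} {n : ℤ} : eta B n = true ↔ n ∈ BFreeSet B := by
  simp [eta]

theorem neg_mem_BFreeSet {B : Set ℕ} {n : ℤ} (h : n ∈ BFreeSet B) : -n ∈ BFreeSet B :=
  fun b hb hd => h b hb ((dvd_neg).1 hd)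

theorem one_mem_BFreeSet {B : Set ℕ} (hB : ∀ b ∈ B, 2 ≤ b) : (1 : ℤ) ∈ BFreeSet B := by
  intro b hb hd
  have h1 := Int.le_of_dvd one_pos hd
  have h2 := hB b hb
  omega

theorem cylinder_mem_nhds (x : ℤ → Bool) (N : ℕ) :
    {y : ℤ → Bool | ∀ n : ℤ, |n| ≤ N → y n = x n} ∈ nhds x := by
  have h : {y : ℤ → Bool | ∀ n : ℤ, |n| ≤ N → y n = x n} =
      Set.pi (Set.Icc (-(N : ℤ)) N) (fun n => {x n}) := by
    ext y
    simp [Set.mem_pi, abs_le]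
  rw [h]
  exact set_pi_mem_nhds (Set.finite_Icc _ _) (fun n _ => by simp)

theorem exists_cylinder_subset {x : ℤ → Bool} {s : Set (ℤ → Bool)} (hs : s ∈ nhds x) :
    ∃ N : ℕ, {y : ℤ → Bool | ∀ n : ℤ, |n| ≤ N → y n = x n} ⊆ s := by
  obtain ⟨o, hos, ho, hxo⟩ := mem_nhds_iff.1 hs
  obtain ⟨I, u, hu, hIu⟩ := isOpen_pi_iff.1 ho x hxo
  refine ⟨I.sup Int.natAbs, fun y hy => hos (hIu ?_)⟩
  intro n hn
  have h1 : n.natAbs ≤ I.sup Int.natAbs := Finset.le_sup (f := Int.natAbs) hn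
  rw [hy n (by rw [Int.abs_eq_natAbs]; omega)]
  exact (hu n hn).2

theorem mem_Xeta_iff {B : Set ℕ} {x : ℤ → Bool} :
    x ∈ Xeta B ↔ ∀ N : ℕ, ∃ t : ℤ, ∀ n : ℤ, |n| ≤ N → eta B (n + t) = x n := by
  constructor
  · intro hx N
    obtain ⟨y, hy, t, rfl⟩ := mem_closure_iff_nhds.1 hx _ (cylinder_mem_nhds x N)
    exact ⟨t, hy⟩
  · intro h
    refine mem_closure_iff_nhds.2 fun s hs => ?_
    obtain ⟨N, hN⟩ := exists_cylinder_subset hs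
    obtain ⟨t, ht⟩ := h N
    exact ⟨shiftPow t (eta B), hN ht, t, rfl⟩

theorem shiftPow_mem_Xeta {B : Set ℕ} {x : ℤ → Bool} (hx : x ∈ Xeta B) (s : ℤ) :
    shiftPow s x ∈ Xeta B := by
  rw [mem_Xeta_iff] at hx ⊢
  intro N
  obtain ⟨t, ht⟩ := hx (N + s.natAbs)
  refine ⟨s + t, fun n hn => ?_⟩
  have := ht (n + s) (by
    push_cast
    exact (abs_add_le _ _).trans (by gcongr))
  rw [← add_assoc, this]
  rfl

theorem eta_mem_Xeta (B : Set ℕ) : eta B ∈ Xeta B :=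
  mem_Xeta_iff.2 fun _ => ⟨0, fun n _ => by rw [add_zero]⟩

theorem shiftPow_zero (x : ℤ → Bool) : shiftPow 0 x = x := by
  funext n
  simp [shiftPow]

theorem shiftPow_shiftPow (s t : ℤ) (x : ℤ → Bool) :
    shiftPow s (shiftPow t x) = shiftPow (s + t) x := by
  funext n
  simp [shiftPow, add_assoc]

theorem IsCA.map_shiftPow {B : Set ℕ} {τ : (ℤ → Bool) → (ℤ → Bool)} (hτ : IsCA (Xeta B) τ)
    {x : ℤ → Bool} (hx : x ∈ Xeta B) (t : ℤ) : τ (shiftPow t x) = shiftPow t (τ x) := by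
  have hnat : ∀ n : ℕ, ∀ x ∈ Xeta B, τ (shiftPow n x) = shiftPow n (τ x) := by
    intro n
    induction n with
    | zero => intro x _; simp [shiftPow_zero]
    | succ n ih =>
      intro x hx
      have h := hτ.2.2 _ (shiftPow_mem_Xeta hx n)
      rw [ih x hx] at h
      simpa [shift, shiftPow_shiftPow, add_comm] using h
  obtain ⟨n, rfl | rfl⟩ := t.eq_nat_or_neg
  · exact hnat n x hx
  · have h := hnat n _ (shiftPow_mem_Xeta hx (-n))
    rw [shiftPow_shiftPow, add_neg_cancel] at h
    rw [shiftPow_zero] at h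
    rw [h, shiftPow_shiftPow, neg_add_cancel, shiftPow_zero]

/-- Curtis–Hedlund–Lyndon: a cellular automaton is given by a sliding block code. -/
theorem IsCA.exists_hasRadius {B : Set ℕ} {τ : (ℤ → Bool) → (ℤ → Bool)}
    (hτ : IsCA (Xeta B) τ) : ∃ ℓ : ℕ, HasRadius (Xeta B) τ ℓ := by
  have hc : IsCompact (Xeta B) := isClosed_closure.isCompact
  have key : ∃ ℓ : ℕ, ∀ x ∈ Xeta B, ∀ y ∈ Xeta B,
      (∀ i : ℤ, |i| ≤ ℓ → y i = x i) → τ x 0 = τ y 0 := by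
    refine hc.induction_on (p := fun s => ∃ ℓ : ℕ, ∀ x ∈ s, ∀ y ∈ Xeta B,
      (∀ i : ℤ, |i| ≤ ℓ → y i = x i) → τ x 0 = τ y 0) ?_ ?_ ?_ ?_
    · exact ⟨0, by simp⟩
    · rintro s t hst ⟨ℓ, h⟩
      exact ⟨ℓ, fun x hx => h x (hst hx)⟩
    · rintro s t ⟨ℓ, h⟩ ⟨m, h'⟩
      refine ⟨max ℓ m, ?_⟩
      rintro x (hx | hx) y hy hi
      · exact h x hx y hy fun i hi' => hi i (by push_cast; exact hi'.trans (le_max_left _ _))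
      · exact h' x hx y hy fun i hi' => hi i (by push_cast; exact hi'.trans (le_max_right _ _))
    · intro x hx
      have h := hτ.2.1 x hx (cylinder_mem_nhds (τ x) 0)
      obtain ⟨u, hu, hux⟩ := mem_nhdsWithin_iff_exists_mem_nhds_inter.1 h
      obtain ⟨N, hN⟩ := exists_cylinder_subset hu
      refine ⟨_, inter_mem_nhdsWithin (Xeta B) (cylinder_mem_nhds x N), N, ?_⟩
      have hval : ∀ y ∈ Xeta B, (∀ i : ℤ, |i| ≤ N → y i = x i) → τ y 0 = τ x 0 :=
        fun y hy hyx => hux ⟨hN hyx, hy⟩ 0 (by simp)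
      rintro z ⟨hzX, hz⟩ y hy hyz
      rw [hval z hzX hz, hval y hy fun i hi => (hyz i hi).trans (hz i hi)]
  obtain ⟨ℓ, h⟩ := key
  refine ⟨ℓ, fun x hx y hy n hxy => ?_⟩
  have := h _ (shiftPow_mem_Xeta hx n) _ (shiftPow_mem_Xeta hy n) (fun i hi => by
    rw [abs_le] at hi
    exact (hxy (i + n) (by omega) (by omega)).symm)
  rw [hτ.map_shiftPow hx, hτ.map_shiftPow hy] at this
  simpa [shiftPow] using this

theorem indicatorSeq_mem_Xeta {B : Set ℕ} (hh : Hereditary (Xeta B)) {A : Finset ℤ} {s : ℤ}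
    (hA : ∀ a ∈ A, a + s ∈ BFreeSet B) : indicatorSeq A ∈ Xeta B := by
  refine hh _ (shiftPow_mem_Xeta (eta_mem_Xeta B) s) _ fun n => ?_
  by_cases hn : n ∈ A
  · have : shiftPow s (eta B) n = true := eta_eq_true_iff.2 (hA n hn)
    rw [this]
    exact Bool.le_true _
  · simp [indicatorSeq, hn]

theorem exists_translate_subset {B : Set ℕ} {x : ℤ → Bool} (hx : x ∈ Xeta B) (T : Finset ℤ)
    (hT : ∀ n ∈ T, x n = true) : ∃ s : ℤ, ∀ n ∈ T, n + s ∈ BFreeSet B := by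
  obtain ⟨s, hs⟩ := mem_Xeta_iff.1 hx (T.sup Int.natAbs)
  refine ⟨s, fun n hn => eta_eq_true_iff.1 ?_⟩
  have h1 : n.natAbs ≤ T.sup Int.natAbs := Finset.le_sup (f := Int.natAbs) hn
  rw [hs n (by rw [Int.abs_eq_natAbs]; omega), hT n hn]

theorem zeroSeq_mem_Xeta {B : Set ℕ} (hh : Hereditary (Xeta B)) : zeroSeq ∈ Xeta B :=
  hh _ (eta_mem_Xeta B) _ fun _ => Bool.false_le _

theorem eq_zero_of_forall_dvd {B : Set ℕ} (hB : ∀ b ∈ B, 2 ≤ b) (hh : Hereditary (Xeta B))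
    {d : ℤ} (hd : ∀ b ∈ B, (b : ℤ) ∣ d) : d = 0 := by
  by_contra hd0
  obtain ⟨t, ht⟩ := mem_Xeta_iff.1 (zeroSeq_mem_Xeta hh) d.natAbs
  have h1 := Int.emod_nonneg (1 - t) hd0
  have h2 := Int.emod_lt_abs (1 - t) hd0
  have h3 := ht ((1 - t) % d) (by
    rw [abs_of_nonneg h1, ← Int.abs_eq_natAbs]
    exact h2.le)
  have h4 : (1 - t) % d + t ∈ BFreeSet B := by
    intro b hb hbd
    refine one_mem_BFreeSet hB b hb ?_
    have h5 := Int.emod_add_mul_ediv (1 - t) d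
    have : (1 : ℤ) = ((1 - t) % d + t) + d * ((1 - t) / d) := by linarith
    rw [this]
    exact dvd_add hbd ((hd b hb).mul_right _)
  rw [eta_eq_true_iff.2 h4] at h3
  simp [zeroSeq] at h3

/-- The union of the residue classes mod `b` that meet the `B`-free integers. -/
def hitClasses (B : Set ℕ) (b : ℕ) : Set ℤ := {n | ∃ f ∈ BFreeSet B, (b : ℤ) ∣ n - f}

theorem mem_hitClasses {B : Set ℕ} {b : ℕ} {n : ℤ} (h : n ∈ BFreeSet B) : n ∈ hitClasses B b :=
  ⟨n, h, by simp⟩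

theorem not_dvd_of_mem_hitClasses {B : Set ℕ} {b : ℕ} (hb : b ∈ B) {n : ℤ}
    (h : n ∈ hitClasses B b) : ¬ (b : ℤ) ∣ n := by
  obtain ⟨f, hf, hd⟩ := h
  intro hn
  exact hf b hb (by simpa using dvd_sub hn hd)

theorem hitClasses_congr {B : Set ℕ} {b : ℕ} {n m : ℤ} (h : n ∈ hitClasses B b)
    (hd : (b : ℤ) ∣ m - n) : m ∈ hitClasses B b := by
  obtain ⟨f, hf, hnf⟩ := h
  exact ⟨f, hf, by simpa using dvd_add hd hnf⟩

theorem hitClasses_add_mul {B : Set ℕ} {b : ℕ} (hb : 2 ≤ b) {t : ℤ}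
    (h : ∀ n ∈ hitClasses B b, n + t ∈ hitClasses B b) (j : ℤ) {n : ℤ}
    (hn : n ∈ hitClasses B b) : n + j * t ∈ hitClasses B b := by
  have hnat : ∀ k : ℕ, n + k * t ∈ hitClasses B b := by
    intro k
    induction k with
    | zero => simpa using hn
    | succ k ih =>
      have := h _ ih
      push_cast
      convert this using 1
      ring
  have h0 := Int.emod_nonneg j (by omega : (b : ℤ) ≠ 0)
  refine hitClasses_congr (hnat (j % b).toNat) ?_
  rw [Int.toNat_of_nonneg h0]
  refine ⟨(j / b) * t, ?_⟩
  have := Int.emod_add_mul_ediv j b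
  linear_combination (-t) * this

theorem hitClasses_sub {B : Set ℕ} {b : ℕ} (hb : 2 ≤ b) {t : ℤ}
    (h : ∀ n ∈ hitClasses B b, n + t ∈ hitClasses B b) {n : ℤ}
    (hn : n + t ∈ hitClasses B b) : n ∈ hitClasses B b := by
  have := hitClasses_add_mul hb h (-1) hn
  simpa using this

/-- Finitely many elements of `F` represent all residue classes mod `b` met by `F`. -/
theorem exists_bound_representatives (F : Set ℤ) {b : ℕ} (hb : 2 ≤ b) :
    ∃ M : ℕ, ∀ f ∈ F, ∃ g ∈ F, |g| ≤ M ∧ (b : ℤ) ∣ f - g := by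
  have hex : ∀ i : ℕ, ∃ g : ℤ, (∃ f ∈ F, (b : ℤ) ∣ f - i) → g ∈ F ∧ (b : ℤ) ∣ g - i := by
    intro i
    by_cases h : ∃ f ∈ F, (b : ℤ) ∣ f - i
    · obtain ⟨f, hf, hd⟩ := h
      exact ⟨f, fun _ => ⟨hf, hd⟩⟩
    · exact ⟨0, fun h' => absurd h' h⟩
  choose g hg using hex
  refine ⟨(Finset.range b).sup fun i => (g i).natAbs, fun f hf => ?_⟩
  have h0 := Int.emod_nonneg f (by omega : (b : ℤ) ≠ 0)
  have h1 := Int.emod_lt_of_pos f (by omega : (0 : ℤ) < b)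
  have h2 := Int.emod_add_mul_ediv f b
  obtain ⟨hgF, hgd⟩ := hg (f % b).toNat ⟨f, hf, f / b, by
    rw [Int.toNat_of_nonneg h0]; linarith⟩
  refine ⟨_, hgF, ?_, ?_⟩
  · have h3 : (g (f % b).toNat).natAbs ≤ (Finset.range b).sup fun i => (g i).natAbs :=
      Finset.le_sup (f := fun i => (g i).natAbs) (Finset.mem_range.2 (by omega))
    rw [Int.abs_eq_natAbs]
    exact_mod_cast h3
  · rw [Int.toNat_of_nonneg h0] at hgd
    have h4 : (b : ℤ) ∣ f - f % b := ⟨f / b, by linarith⟩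
    simpa using dvd_sub h4 hgd

/-- If `X_η` is hereditary, every central window of `η` with one `1` deleted
recurs (from below) arbitrarily far away. -/
theorem exists_large_return {B : Set ℕ} (hh : Hereditary (Xeta B)) {m : ℤ}
    (hm : m ∈ BFreeSet B) (M N : ℕ) :
    ∃ t : ℤ, (N : ℤ) < |t| ∧
      ∀ n : ℤ, |n| ≤ M → n ≠ m → n ∈ BFreeSet B → n + t ∈ BFreeSet B := by
  set η' : ℤ → Bool := Function.update (eta B) m false with hη'
  have hX : η' ∈ Xeta B := by
    refine hh _ (eta_mem_Xeta B) _ fun n => ?_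
    by_cases h : n = m
    · subst h; simp [hη']
    · simp [hη', h]
  rw [mem_Xeta_iff] at hX
  by_contra! hcon
  have hbad : ∀ t : ℤ, ∃ K : ℕ, ∃ n : ℤ, |n| ≤ K ∧ eta B (n + t) ≠ η' n := by
    intro t
    by_contra! hall
    have hall' : ∀ n, eta B (n + t) = η' n := fun n => hall n.natAbs n (Int.abs_eq_natAbs n).le
    have h1 : eta B (m + t) = false := by rw [hall' m]; simp [hη']
    have h2 : η' (-m - t) = true := by
      rw [← hall', sub_add_cancel]
      exact eta_eq_true_iff.2 (neg_mem_BFreeSet hm)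
    have h3 : eta B (-m - t) = true := by
      by_cases h : -m - t = m
      · rw [h] at h2; simp [hη'] at h2
      · simpa [hη', h] using h2
    have h4 := eta_eq_true_iff.2 (neg_mem_BFreeSet (eta_eq_true_iff.1 h3))
    rw [show -(-m - t) = m + t by ring, h1] at h4
    exact absurd h4 (by simp)
  choose K hK using hbad
  obtain ⟨t, ht⟩ := hX (max M ((Finset.Icc (-(N : ℤ)) N).sup K))
  have htN : |t| ≤ N := by
    by_contra! h
    obtain ⟨n, hn, hnm, hnF, hnt⟩ := hcon t h
    refine hnt (eta_eq_true_iff.1 ?_)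
    rw [ht n (by push_cast; exact hn.trans (le_max_left _ _))]
    simpa [hη', hnm] using eta_eq_true_iff.2 hnF
  obtain ⟨n, hn, hne⟩ := hK t
  have hKt : K t ≤ (Finset.Icc (-(N : ℤ)) N).sup K :=
    Finset.le_sup (f := K) (Finset.mem_Icc.2 (abs_le.1 htN))
  exact hne (ht n (hn.trans (by exact_mod_cast hKt.trans (le_max_right _ _))))

theorem infinite_of_forall_exists_lt_abs {F : Set ℤ} (h : ∀ N : ℕ, ∃ n ∈ F, (N : ℤ) < |n|) :
    F.Infinite := by
  intro hF
  obtain ⟨n, hn, hlt⟩ := h (hF.toFinset.sup Int.natAbs)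
  have : n.natAbs ≤ hF.toFinset.sup Int.natAbs :=
    Finset.le_sup (f := Int.natAbs) (hF.mem_toFinset.2 hn)
  rw [Int.abs_eq_natAbs] at hlt
  omega

theorem infinite_BFreeSet {B : Set ℕ} (hB : ∀ b ∈ B, 2 ≤ b) (hh : Hereditary (Xeta B)) :
    (BFreeSet B).Infinite := by
  refine infinite_of_forall_exists_lt_abs fun N => ?_
  obtain ⟨t, ht, h⟩ := exists_large_return hh (one_mem_BFreeSet hB) 1 (N + 1)
  refine ⟨-1 + t, h (-1) (by simp) (by decide) (neg_mem_BFreeSet (one_mem_BFreeSet hB)), ?_⟩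
  push_cast at ht
  rw [lt_abs] at ht ⊢
  omega

/-- Every residue class that meets the `B`-free integers does so infinitely often. -/
theorem infinite_BFreeSet_inter_class {B : Set ℕ} (hB : ∀ b ∈ B, 2 ≤ b)
    (hh : Hereditary (Xeta B)) {b : ℕ} (hb : b ∈ B) {f : ℤ} (hf : f ∈ hitClasses B b) :
    {n | n ∈ BFreeSet B ∧ (b : ℤ) ∣ n - f}.Infinite := by
  have hb2 := hB b hb
  obtain ⟨m, hm, m', hm', hne, hmm⟩ : ∃ m ∈ BFreeSet B, ∃ m' ∈ BFreeSet B, m ≠ m' ∧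
      m % (b : ℤ) = m' % (b : ℤ) :=
    (infinite_BFreeSet hB hh).exists_ne_map_eq_of_mapsTo
      (t := Set.Icc 0 (b : ℤ)) (f := fun n => n % (b : ℤ))
      (fun n _ => ⟨Int.emod_nonneg _ (by omega), (Int.emod_lt_of_pos _ (by omega)).le⟩)
      (Set.finite_Icc _ _)
  have hdvd : (b : ℤ) ∣ m - m' := Int.ModEq.dvd hmm.symm
  obtain ⟨M, hM⟩ := exists_bound_representatives (BFreeSet B \ {m}) hb2
  have hrep : ∀ n ∈ hitClasses B b, ∃ g ∈ BFreeSet B, g ≠ m ∧ |g| ≤ M ∧ (b : ℤ) ∣ n - g := by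
    rintro n ⟨a, ha, hna⟩
    obtain ⟨a', ha', haa'⟩ : ∃ a' ∈ BFreeSet B \ {m}, (b : ℤ) ∣ a - a' := by
      by_cases h : a = m
      · exact ⟨m', ⟨hm', fun h' => hne h'.symm⟩, h ▸ hdvd⟩
      · exact ⟨a, ⟨ha, h⟩, by simp⟩
    obtain ⟨g, hg, hgM, hga⟩ := hM a' ha'
    exact ⟨g, hg.1, hg.2, hgM, by simpa using dvd_add hna (dvd_add haa' hga)⟩
  refine infinite_of_forall_exists_lt_abs fun N => ?_
  obtain ⟨t, ht, hret⟩ := exists_large_return hh hm M (N + M)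
  have hstab : ∀ n ∈ hitClasses B b, n + t ∈ hitClasses B b := by
    intro n hn
    obtain ⟨g, hg, hgm, hgM, hgd⟩ := hrep n hn
    exact ⟨g + t, hret g hgM hgm hg, by simpa using hgd⟩
  have hft : f - t ∈ hitClasses B b := hitClasses_sub hb2 hstab (by simpa using hf)
  obtain ⟨g, hg, hgm, hgM, hgd⟩ := hrep _ hft
  refine ⟨g + t, ⟨hret g hgM hgm hg, ?_⟩, ?_⟩
  · rwa [show f - t - g = -(g + t - f) by ring, dvd_neg] at hgd
  · push_cast at ht
    rw [lt_abs] at ht ⊢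
    rw [abs_le] at hgM
    omega

/-- A sparse finite set of `B`-free integers, far from `A`, that meets every residue class
mod `b` met by the `B`-free integers. -/
theorem exists_sparse_cover {B : Set ℕ} (hB : ∀ b ∈ B, 2 ≤ b) (hh : Hereditary (Xeta B))
    {b : ℕ} (hb : b ∈ B) (A : Finset ℤ) (L : ℕ) :
    ∃ D : Finset ℤ, (∀ d ∈ D, d ∈ BFreeSet B) ∧ (∀ n ∈ hitClasses B b, ∃ d ∈ D, (b : ℤ) ∣ n - d) ∧
      ∀ d ∈ D, ∀ e ∈ A ∪ D, e ≠ d → (L : ℤ) < |e - d| := by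
  have key : ∀ R : Finset ℤ, (∀ r ∈ R, r ∈ hitClasses B b) →
      ∃ D : Finset ℤ, (∀ d ∈ D, d ∈ BFreeSet B) ∧ (∀ r ∈ R, ∃ d ∈ D, (b : ℤ) ∣ r - d) ∧
      ∀ d ∈ D, ∀ e ∈ A ∪ D, e ≠ d → (L : ℤ) < |e - d| := by
    intro R
    induction R using Finset.induction_on with
    | empty => exact fun _ => ⟨∅, by simp⟩
    | insert r R hr ih =>
      intro hR
      obtain ⟨D, hDF, hDR, hDs⟩ := ih fun s hs => hR s (Finset.mem_insert_of_mem hs)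
      obtain ⟨n, ⟨hnF, hnr⟩, hnot⟩ :=
        (infinite_BFreeSet_inter_class hB hh hb (hR r (Finset.mem_insert_self _ _))).exists_notMem_finset
        ((A ∪ D).biUnion fun e => Finset.Icc (e - L) (e + L))
      have hfar : ∀ e ∈ A ∪ D, (L : ℤ) < |e - n| := by
        intro e he
        by_contra! h
        rw [abs_le] at h
        exact hnot (Finset.mem_biUnion.2 ⟨e, he, Finset.mem_Icc.2 (by omega)⟩)
      refine ⟨insert n D, ?_, ?_, ?_⟩
      · intro d hd
        rcases Finset.mem_insert.1 hd with rfl | hd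
        · exact hnF
        · exact hDF d hd
      · intro s hs
        rcases Finset.mem_insert.1 hs with rfl | hs
        · exact ⟨n, Finset.mem_insert_self _ _, (dvd_sub_comm).1 hnr⟩
        · obtain ⟨d, hd, h⟩ := hDR s hs
          exact ⟨d, Finset.mem_insert_of_mem hd, h⟩
      · intro d hd e he hed
        rw [Finset.union_insert, Finset.mem_insert] at he
        rcases Finset.mem_insert.1 hd with rfl | hdD
        · exact hfar e (he.resolve_left hed)
        · rcases he with rfl | he
          · rw [abs_sub_comm]
            exact hfar d (Finset.mem_union_right _ hdD)
          · exact hDs d hdD e he hed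
  obtain ⟨M, hM⟩ := exists_bound_representatives (BFreeSet B) (hB b hb)
  classical
  obtain ⟨D, hDF, hDR, hDs⟩ := key ((Finset.Icc (-(M : ℤ)) M).filter (· ∈ BFreeSet B))
    fun r hr => mem_hitClasses (Finset.mem_filter.1 hr).2
  refine ⟨D, hDF, ?_, hDs⟩
  rintro n ⟨f, hf, hnf⟩
  obtain ⟨g, hg, hgM, hgd⟩ := hM f hf
  obtain ⟨d, hd, h⟩ := hDR g (Finset.mem_filter.2 ⟨Finset.mem_Icc.2 (abs_le.1 hgM), hg⟩)
  exact ⟨d, hd, by simpa using dvd_add hnf (dvd_add hgd h)⟩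

theorem hitClasses_add_of_cover {B : Set ℕ} {b : ℕ} {D : Finset ℤ} {s : ℤ}
    (hcov : ∀ n ∈ hitClasses B b, ∃ d ∈ D, (b : ℤ) ∣ n - d)
    (hs : ∀ d ∈ D, d + s ∈ BFreeSet B) : ∀ n ∈ hitClasses B b, n + s ∈ hitClasses B b := by
  intro n hn
  obtain ⟨d, hd, h⟩ := hcov n hn
  exact ⟨d + s, hs d hd, by simpa using h⟩

/-- A code of radius `ℓ` fixing the zero sequence sees separated parts of a configuration
independently. -/
theorem HasRadius.apply_indicatorSeq_of_subset {X : Set (ℤ → Bool)}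
    {τ : (ℤ → Bool) → (ℤ → Bool)} {ℓ : ℕ} (hr : HasRadius X τ ℓ) (h0X : zeroSeq ∈ X)
    (h0 : τ zeroSeq = zeroSeq) {A E : Finset ℤ} (hA : indicatorSeq A ∈ X)
    (hE : indicatorSeq E ∈ X) (hAE : A ⊆ E)
    (hfar : ∀ a ∈ A, ∀ e ∈ E, e ∉ A → ((2 * ℓ : ℕ) : ℤ) < |e - a|) {n : ℤ}
    (hn : τ (indicatorSeq A) n = true) : τ (indicatorSeq E) n = true := by
  by_cases hex : ∃ a ∈ A, |n - a| ≤ ℓ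
  · obtain ⟨a, ha, hna⟩ := hex
    rw [← hn]
    refine hr _ hE _ hA n fun i h1 h2 => ?_
    by_cases hi : i ∈ A
    · simp [indicatorSeq, hi, hAE hi]
    · have : i ∉ E := by
        intro hiE
        have h3 := hfar a ha i hiE hi
        rw [lt_abs] at h3
        rw [abs_le] at hna
        push_cast at h3
        omega
      simp [indicatorSeq, hi, this]
  · push Not at hex
    exfalso
    have : τ (indicatorSeq A) n = τ zeroSeq n := by
      refine hr _ hA _ h0X n fun i h1 h2 => ?_
      have : i ∉ A := by
        intro hi
        have h3 := hex i hi
        rw [lt_abs] at h3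
        omega
      simp [indicatorSeq, zeroSeq, this]
    rw [this, h0] at hn
    simp [zeroSeq] at hn

theorem IsCA.map_zeroSeq {B : Set ℕ} (hB : ∀ b ∈ B, 2 ≤ b) (hh : Hereditary (Xeta B))
    {τ : (ℤ → Bool) → (ℤ → Bool)} (hτ : IsCA (Xeta B) τ) : τ zeroSeq = zeroSeq := by
  have h0 := zeroSeq_mem_Xeta hh
  have hconst : ∀ n, τ zeroSeq n = τ zeroSeq 0 := by
    intro n
    have h := congrFun (hτ.map_shiftPow h0 n) 0
    rw [show shiftPow n zeroSeq = zeroSeq from rfl] at h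
    simpa [shiftPow] using h.symm
  obtain ⟨b, hb, -⟩ : ∃ b ∈ B, ¬ (b : ℤ) ∣ 1 := by
    by_contra! h
    exact one_ne_zero (eq_zero_of_forall_dvd hB hh h)
  have hb2 := hB b hb
  obtain ⟨t, ht⟩ := mem_Xeta_iff.1 (hτ.1 h0) b
  have h1 := Int.emod_nonneg (-t) (by omega : (b : ℤ) ≠ 0)
  have h2 := Int.emod_lt_of_pos (-t) (by omega : (0 : ℤ) < b)
  have h3 := ht ((-t) % b) (by rw [abs_of_nonneg h1]; exact h2.le)
  have h4 : eta B ((-t) % b + t) = false := by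
    rw [← Bool.not_eq_true, eta_eq_true_iff]
    intro h
    refine h b hb ⟨-((-t) / b), ?_⟩
    have := Int.emod_add_mul_ediv (-t) b
    linarith
  funext n
  rw [hconst n, ← hconst ((-t) % b), ← h3, h4]
  rfl

theorem indicatorSeq_shift (A : Finset ℤ) (s : ℤ) :
    shiftPow (-s) (indicatorSeq A) = indicatorSeq (A.image (· + s)) := by
  funext n
  simp only [shiftPow, indicatorSeq, Finset.mem_image, decide_eq_decide]
  constructor
  · exact fun h => ⟨_, h, by ring⟩
  · rintro ⟨a, ha, rfl⟩
    simpa using ha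

theorem IsCA.map_indicatorSeq_image_add {B : Set ℕ} {τ : (ℤ → Bool) → (ℤ → Bool)}
    (hτ : IsCA (Xeta B) τ) {A : Finset ℤ} (hA : indicatorSeq A ∈ Xeta B) (s n : ℤ) :
    τ (indicatorSeq (A.image (· + s))) (n + s) = τ (indicatorSeq A) n := by
  rw [← indicatorSeq_shift, hτ.map_shiftPow hA]
  simp [shiftPow]

theorem indicatorSeq_singleton_mem_Xeta {B : Set ℕ} (hB : ∀ b ∈ B, 2 ≤ b)
    (hh : Hereditary (Xeta B)) (d : ℤ) : indicatorSeq {d} ∈ Xeta B :=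
  indicatorSeq_mem_Xeta hh (s := 1 - d) (by simpa using one_mem_BFreeSet hB)

theorem IsCA.map_indicatorSeq_singleton {B : Set ℕ} (hB : ∀ b ∈ B, 2 ≤ b)
    (hh : Hereditary (Xeta B)) {τ : (ℤ → Bool) → (ℤ → Bool)} (hτ : IsCA (Xeta B) τ) (d k : ℤ) :
    τ (indicatorSeq {d}) (d + k) = τ (indicatorSeq {0}) k := by
  have := hτ.map_indicatorSeq_image_add (indicatorSeq_singleton_mem_Xeta hB hh 0) d k
  simpa [add_comm] using this

/-- If a cellular automaton preserves the `1` of a configuration with a single `1`, then it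
maps finite sets of `B`-free integers to sets of `B`-free integers. -/
theorem IsCA.apply_mem_BFreeSet {B : Set ℕ} (hB : ∀ b ∈ B, 2 ≤ b)
    (hh : Hereditary (Xeta B)) {τ : (ℤ → Bool) → (ℤ → Bool)} (hτ : IsCA (Xeta B) τ)
    (h1 : τ (indicatorSeq {0}) 0 = true) {A : Finset ℤ} (hA : ∀ a ∈ A, a ∈ BFreeSet B) {n : ℤ}
    (hn : τ (indicatorSeq A) n = true) : n ∈ BFreeSet B := by
  obtain ⟨ℓ, hr⟩ := hτ.exists_hasRadius
  intro b hb
  obtain ⟨D, hDF, hcov, hsp⟩ := exists_sparse_cover hB hh hb A (2 * ℓ)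
  have hAX : indicatorSeq A ∈ Xeta B := indicatorSeq_mem_Xeta hh (s := 0) (by simpa using hA)
  have hEX : indicatorSeq (A ∪ D) ∈ Xeta B := indicatorSeq_mem_Xeta hh (s := 0) (by
    intro a ha
    rw [add_zero]
    exact (Finset.mem_union.1 ha).elim (hA a) (hDF a))
  have hz := hτ.map_zeroSeq hB hh
  have hnE : τ (indicatorSeq (A ∪ D)) n = true := by
    refine hr.apply_indicatorSeq_of_subset (zeroSeq_mem_Xeta hh) hz hAX hEX
      Finset.subset_union_left ?_ hn
    intro a ha e he heA
    rw [abs_sub_comm]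
    exact hsp e ((Finset.mem_union.1 he).resolve_left heA) a (Finset.mem_union_left _ ha)
      (fun h => heA (h ▸ ha))
  have hdE : ∀ d ∈ D, τ (indicatorSeq (A ∪ D)) d = true := by
    intro d hd
    refine hr.apply_indicatorSeq_of_subset (zeroSeq_mem_Xeta hh) hz
      (indicatorSeq_singleton_mem_Xeta hB hh d) hEX
      (by simpa using Or.inr hd) ?_ (by
        have := hτ.map_indicatorSeq_singleton hB hh d 0
        rwa [add_zero, h1] at this)
    intro a ha e he hea
    rw [Finset.mem_singleton] at ha hea
    subst ha
    exact hsp a hd e he hea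
  obtain ⟨s, hs⟩ := exists_translate_subset (hτ.1 hEX) (insert n D) (by
    intro m hm
    rcases Finset.mem_insert.1 hm with rfl | hm
    · exact hnE
    · exact hdE m hm)
  have hst := hitClasses_add_of_cover hcov fun d hd => hs d (Finset.mem_insert_of_mem hd)
  exact not_dvd_of_mem_hitClasses hb (hitClasses_sub (hB b hb) hst
    (mem_hitClasses (hs n (Finset.mem_insert_self _ _))))

theorem IsCA.mem_of_apply_indicatorSeq {B : Set ℕ} (hB : ∀ b ∈ B, 2 ≤ b)
    (hh : Hereditary (Xeta B)) {τ : (ℤ → Bool) → (ℤ → Bool)} (hτ : IsCA (Xeta B) τ)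
    (h1 : τ (indicatorSeq {0}) 0 = true) {A : Finset ℤ} (hA : indicatorSeq A ∈ Xeta B) {n : ℤ}
    (hn : τ (indicatorSeq A) n = true) : n ∈ A := by
  obtain ⟨s, hs⟩ := mem_Xeta_iff.1 hA ((insert n A).sup Int.natAbs)
  have hs' : ∀ m ∈ insert n A, eta B (m + s) = indicatorSeq A m := by
    intro m hm
    have : m.natAbs ≤ (insert n A).sup Int.natAbs := Finset.le_sup (f := Int.natAbs) hm
    exact hs m (by rw [Int.abs_eq_natAbs]; omega)
  have hAs : ∀ a ∈ A.image (· + s), a ∈ BFreeSet B := by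
    intro a ha
    obtain ⟨c, hc, rfl⟩ := Finset.mem_image.1 ha
    rw [← eta_eq_true_iff, hs' c (Finset.mem_insert_of_mem hc)]
    simpa [indicatorSeq] using hc
  have h2 := hτ.apply_mem_BFreeSet hB hh h1 hAs
    ((hτ.map_indicatorSeq_image_add hA s n).trans hn)
  rw [← eta_eq_true_iff, hs' n (Finset.mem_insert_self _ _)] at h2
  simpa [indicatorSeq] using h2

theorem IsCA.map_indicatorSeq_eq_self {B : Set ℕ} (hB : ∀ b ∈ B, 2 ≤ b)
    (hh : Hereditary (Xeta B)) {τ : (ℤ → Bool) → (ℤ → Bool)} (hτ : IsCA (Xeta B) τ)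
    (hinj : Set.InjOn τ (Xeta B)) (h1 : τ (indicatorSeq {0}) 0 = true) (A : Finset ℤ)
    (hA : indicatorSeq A ∈ Xeta B) : τ (indicatorSeq A) = indicatorSeq A := by
  induction A using Finset.strongInduction with
  | H A ih =>
    set A' := A.filter fun n => τ (indicatorSeq A) n = true with hA'
    have hτA : τ (indicatorSeq A) = indicatorSeq A' := by
      funext n
      rw [Bool.eq_iff_iff]
      simp only [indicatorSeq, hA', Finset.mem_filter, decide_eq_true_eq]
      exact ⟨fun h => ⟨hτ.mem_of_apply_indicatorSeq hB hh h1 hA h, h⟩, fun h => h.2⟩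
    have hsub : A' ⊆ A := Finset.filter_subset _ A
    rcases hsub.eq_or_ssubset with h | h
    · rw [hτA, h]
    · have hA'X : indicatorSeq A' ∈ Xeta B := hτA ▸ hτ.1 hA
      have h2 := ih A' h hA'X
      rw [hτA, hinj hA'X hA (h2.trans hτA.symm)]

theorem IsCA.eqOn_id {B : Set ℕ} (hB : ∀ b ∈ B, 2 ≤ b)
    (hh : Hereditary (Xeta B)) {τ : (ℤ → Bool) → (ℤ → Bool)} (hτ : IsCA (Xeta B) τ)
    (hinj : Set.InjOn τ (Xeta B)) (h1 : τ (indicatorSeq {0}) 0 = true) :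
    Set.EqOn τ id (Xeta B) := by
  intro x hx
  obtain ⟨ℓ, hr⟩ := hτ.exists_hasRadius
  funext n
  set A := (Finset.Icc (n - ℓ) (n + ℓ)).filter fun i => x i = true with hA
  have hAX : indicatorSeq A ∈ Xeta B := by
    refine hh x hx _ fun i => ?_
    cases hxi : x i <;> simp [indicatorSeq, hA, hxi, Bool.le_true]
  have hagree : ∀ i : ℤ, n - ℓ ≤ i → i ≤ n + ℓ → x i = indicatorSeq A i := by
    intro i h2 h3
    simp [indicatorSeq, hA, h2, h3]
  rw [hr x hx _ hAX n hagree, hτ.map_indicatorSeq_eq_self hB hh hinj h1 A hAX,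
    ← hagree n (by omega) (by omega)]
  rfl

theorem continuous_shiftPow (t : ℤ) : Continuous (shiftPow t) :=
  continuous_pi fun n => continuous_apply (n + t)

theorem IsCA.shiftPow_comp {B : Set ℕ} {τ : (ℤ → Bool) → (ℤ → Bool)} (hτ : IsCA (Xeta B) τ)
    (t : ℤ) : IsCA (Xeta B) (fun x => shiftPow t (τ x)) := by
  refine ⟨fun x hx => shiftPow_mem_Xeta (hτ.1 hx) t,
    (continuous_shiftPow t).comp_continuousOn hτ.2.1, fun x hx => ?_⟩
  beta_reduce
  rw [hτ.2.2 x hx]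
  simp only [shift, shiftPow_shiftPow, add_comm]

/-- if the `B`-free subshift is hereditary, its automorphism group is
trivial: every bijective CA equals a power of the shift. -/
theorem aut_trivial_of_hereditary (B : Set ℕ)
    (hBpos : ∀ b ∈ B, 2 ≤ b) (hBprim : Primitive B)
    (hhered : Hereditary (Xeta B))
    (τ : (ℤ → Bool) → (ℤ → Bool)) (hτ : IsCA (Xeta B) τ)
    (hbij : Set.BijOn τ (Xeta B) (Xeta B)) :
    ∃ t : ℤ, Set.EqOn τ (shiftPow t) (Xeta B) := by
  have h0X := zeroSeq_mem_Xeta hhered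
  have huX := indicatorSeq_singleton_mem_Xeta hBpos hhered 0
  obtain ⟨k, hk⟩ : ∃ k, τ (indicatorSeq {0}) k = true := by
    by_contra! h
    have h2 : τ (indicatorSeq {0}) = τ zeroSeq := by
      rw [hτ.map_zeroSeq hBpos hhered]
      funext n
      simpa [zeroSeq] using h n
    have h3 := congrFun (hbij.injOn huX h0X h2) 0
    simp [indicatorSeq, zeroSeq] at h3
  have hcancel : ∀ x, shiftPow (-k) (shiftPow k x) = x := by
    intro x
    rw [shiftPow_shiftPow, neg_add_cancel, shiftPow_zero]
  have hid := (hτ.shiftPow_comp k).eqOn_id hBpos hhered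
    (fun x hx y hy hxy => hbij.injOn hx hy (by
      rw [← hcancel (τ x), ← hcancel (τ y)]
      exact congrArg _ hxy))
    (by simpa [shiftPow] using hk)
  refine ⟨-k, fun x hx => ?_⟩
  rw [← hcancel (τ x)]
  exact congrArg _ (hid hx)
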